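/- arXiv:2006.04732 — 8 statements merged into one kernel-verified Lean document; each statement's English description precedes it below -/
import Mathlib

section
/- Suppose the interpretable model is correctly specified, i.e. μ[Y | σ(X)] = h(X) + r(Z) μ-almost everywhere, with Y, h(X) and r(Z) integrable. Then for every bounded measurable function A : ℝ^p → ℝ and every bounded measurable function g : ℝ^d → ℝ (a possibly misspecified model for E[A(X) | Z]), the estimating function has mean zero: ∫ (A(X) − g(Z)) · (Y − h(X) − r(Z)) dμ = 0. -/
open MeasureTheory

/-- Double robustness, first half: if the interpretable model is correctly
specified, `μ[Y | σ(X)] = h(X) + r(Z)` a.e., then for every bounded measurable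
`A : ℝ^p → ℝ` and every bounded measurable `g : ℝ^d → ℝ` (a possibly
misspecified model for `E[A(X) | Z]`), the estimating function has mean zero. -/
theorem stmt_0
    {Ω : Type*} [m0 : MeasurableSpace Ω] {μ : Measure Ω} [IsProbabilityMeasure μ]
    {p d : ℕ}
    (X : Ω → (Fin p → ℝ)) (Z : Ω → (Fin d → ℝ)) (Y : Ω → ℝ)
    (hX : Measurable X) (hZ : Measurable Z)
    (hZX : MeasurableSpace.comap Z inferInstance ≤ MeasurableSpace.comap X inferInstance)
    (hXm : MeasurableSpace.comap X inferInstance ≤ m0)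
    (hYint : Integrable Y μ)
    (h : (Fin p → ℝ) → ℝ) (r : (Fin d → ℝ) → ℝ)
    (hh : Measurable h) (hr : Measurable r)
    (hhint : Integrable (fun ω => h (X ω)) μ)
    (hrint : Integrable (fun ω => r (Z ω)) μ)
    (hmodel : μ[Y | MeasurableSpace.comap X inferInstance]
      =ᵐ[μ] fun ω => h (X ω) + r (Z ω)) :
    ∀ A : (Fin p → ℝ) → ℝ, Measurable A → (∃ C, ∀ x, |A x| ≤ C) →
    ∀ g : (Fin d → ℝ) → ℝ, Measurable g → (∃ C, ∀ z, |g z| ≤ C) →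
    ∫ ω, (A (X ω) - g (Z ω)) * (Y ω - h (X ω) - r (Z ω)) ∂μ = 0 := by
  intro A hA ⟨C, hC⟩ g hg ⟨D, hD⟩
  have hXc : Measurable[MeasurableSpace.comap X inferInstance] X := comap_measurable X
  have hZc : Measurable[MeasurableSpace.comap X inferInstance] Z :=
    (comap_measurable Z).mono hZX le_rfl
  have hfm : Measurable[MeasurableSpace.comap X inferInstance]
      (fun ω => A (X ω) - g (Z ω)) :=
    Measurable.sub (hA.comp hXc) (hg.comp hZc)
  have hb : ∀ᵐ ω ∂μ, ‖A (X ω) - g (Z ω)‖ ≤ C + D := by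
    refine Filter.Eventually.of_forall fun ω => ?_
    exact (norm_sub_le _ _).trans (add_le_add (hC _) (hD _))
  have hf0 : AEStronglyMeasurable (fun ω => A (X ω) - g (Z ω)) μ :=
    (hfm.mono hXm le_rfl).aestronglyMeasurable
  have key := condExp_stronglyMeasurable_mul_of_bound hXm hfm.stronglyMeasurable hYint (C + D) hb
  have i1 : Integrable (fun ω => (A (X ω) - g (Z ω)) * Y ω) μ := hYint.bdd_mul hf0 hb
  have i2 : Integrable (fun ω => (A (X ω) - g (Z ω)) * (h (X ω) + r (Z ω))) μ :=
    (hhint.add hrint).bdd_mul hf0 hb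
  have e : ∫ ω, (A (X ω) - g (Z ω)) * Y ω ∂μ
      = ∫ ω, (A (X ω) - g (Z ω)) * (h (X ω) + r (Z ω)) ∂μ := by
    have e1 := integral_condExp (μ := μ) (f := (fun ω => A (X ω) - g (Z ω)) * Y) hXm
    refine e1.symm.trans (integral_congr_ae ?_)
    filter_upwards [key, hmodel] with ω h1 h2
    rw [h1, Pi.mul_apply, h2]
  have e2 : ∀ ω, (A (X ω) - g (Z ω)) * (Y ω - h (X ω) - r (Z ω))
      = (A (X ω) - g (Z ω)) * Y ω - (A (X ω) - g (Z ω)) * (h (X ω) + r (Z ω)) :=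
    fun ω => by ring
  simp_rw [e2]
  rw [integral_sub i1 i2, e, sub_self]
end

section
/- Suppose μ[Y | σ(X)] = h(X) + r(Z) μ-almost everywhere, with Y, h(X) and r(Z) integrable. Then for every bounded measurable function A : ℝ^p → ℝ, the element of the orthogonal complement of the nuisance tangent space has mean zero under the truth: ∫ (A(X) − μ[A(X) | σ(Z)]) · (Y − h(X) − r(Z)) dμ = 0. -/
open MeasureTheory

/-- Unbiasedness of elements of the orthogonal complement of the nuisance
tangent space (Theorem 1): under the interpretable model
`μ[Y | σ(X)] = h(X) + r(Z)` a.e., for every bounded measurable `A`,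
`∫ (A(X) − μ[A(X) | σ(Z)]) · (Y − h(X) − r(Z)) dμ = 0`. -/
theorem stmt_1
    {Ω : Type*} [m0 : MeasurableSpace Ω] {μ : Measure Ω} [IsProbabilityMeasure μ]
    {p d : ℕ}
    (X : Ω → (Fin p → ℝ)) (Z : Ω → (Fin d → ℝ)) (Y : Ω → ℝ)
    (hX : Measurable X) (hZ : Measurable Z)
    (hZX : MeasurableSpace.comap Z inferInstance ≤ MeasurableSpace.comap X inferInstance)
    (hXm : MeasurableSpace.comap X inferInstance ≤ m0)
    (hYint : Integrable Y μ)
    (h : (Fin p → ℝ) → ℝ) (r : (Fin d → ℝ) → ℝ)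
    (hh : Measurable h) (hr : Measurable r)
    (hhint : Integrable (fun ω => h (X ω)) μ)
    (hrint : Integrable (fun ω => r (Z ω)) μ)
    (hmodel : μ[Y | MeasurableSpace.comap X inferInstance]
      =ᵐ[μ] fun ω => h (X ω) + r (Z ω)) :
    ∀ A : (Fin p → ℝ) → ℝ, Measurable A → (∃ C, ∀ x, |A x| ≤ C) →
    ∫ ω, (A (X ω) - (μ[fun ω' => A (X ω') | MeasurableSpace.comap Z inferInstance]) ω)
      * (Y ω - h (X ω) - r (Z ω)) ∂μ = 0 := by
  intro A hA hC
  obtain ⟨C, hC⟩ := hC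
  have hXX : Measurable[MeasurableSpace.comap X inferInstance] X := comap_measurable X
  have hZZ : Measurable[MeasurableSpace.comap X inferInstance] Z :=
    (comap_measurable Z).mono hZX le_rfl
  have hC0 : 0 ≤ C := (abs_nonneg _).trans (hC 0)
  have hs1 : Integrable (fun ω => h (X ω) + r (Z ω)) μ := hhint.add hrint
  have hs2 : StronglyMeasurable[MeasurableSpace.comap X inferInstance]
      (fun ω => h (X ω) + r (Z ω)) :=
    Measurable.stronglyMeasurable ((hh.comp hXX).add (hr.comp hZZ))
  have hgint : Integrable (Y - fun ω => h (X ω) + r (Z ω)) μ := hYint.sub hs1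
  have hg0 : μ[Y - (fun ω => h (X ω) + r (Z ω)) | MeasurableSpace.comap X inferInstance]
      =ᵐ[μ] 0 := by
    have e1 := condExp_sub hYint hs1 (MeasurableSpace.comap X inferInstance)
    rw [condExp_of_stronglyMeasurable hXm hs2 hs1] at e1
    filter_upwards [e1, hmodel] with ω h1 h2
    rw [h1, Pi.sub_apply, h2]
    simp
  have hbd : ∀ᵐ ω ∂μ,
      |(μ[fun ω' => A (X ω') | MeasurableSpace.comap Z inferInstance]) ω| ≤ C :=
    ae_bdd_condExp_of_ae_bdd (R := ⟨C, hC0⟩) (Filter.Eventually.of_forall fun ω => hC (X ω))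
  have hf : StronglyMeasurable[MeasurableSpace.comap X inferInstance]
      ((fun ω => A (X ω)) - μ[fun ω' => A (X ω') | MeasurableSpace.comap Z inferInstance]) :=
    (Measurable.stronglyMeasurable (hA.comp hXX)).sub (stronglyMeasurable_condExp.mono hZX)
  have key := condExp_stronglyMeasurable_mul_of_bound hXm hf hgint (C + C) (by
    filter_upwards [hbd] with ω hω
    exact (norm_sub_le _ _).trans (add_le_add (hC _) hω))
  have hz : μ[((fun ω => A (X ω)) - μ[fun ω' => A (X ω') | MeasurableSpace.comap Z inferInstance])
      * (Y - fun ω => h (X ω) + r (Z ω)) | MeasurableSpace.comap X inferInstance] =ᵐ[μ] 0 := by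
    filter_upwards [key, hg0] with ω h1 h2
    rw [h1, Pi.mul_apply, h2]
    simp
  have hi := integral_condExp (μ := μ) hXm
    (f := ((fun ω => A (X ω)) - μ[fun ω' => A (X ω') | MeasurableSpace.comap Z inferInstance])
      * (Y - fun ω => h (X ω) + r (Z ω)))
  rw [integral_congr_ae hz] at hi
  simp only [Pi.mul_apply, Pi.sub_apply, Pi.zero_apply, integral_zero] at hi
  simp only [← sub_sub] at hi
  exact hi.symm
end

section
/- Suppose μ[Y | σ(X)] = h(X) + r(Z) μ-almost everywhere, with Y, h(X) and r(Z) integrable. Then for every bounded measurable function A : ℝ^p → ℝ and every measurable function r* : ℝ^d → ℝ with r*(Z) integrable, the following reduction identity holds: ∫ (A(X) − μ[A(X) | σ(Z)]) · (Y − h(X) − r*(Z)) dμ = ∫ (A(X) − μ[A(X) | σ(Z)]) · (r(Z) − r*(Z)) dμ. -/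
open MeasureTheory

/-- Intermediate reduction identity in the proof of Lemma 1: replacing the
correctly specified `r` by a possibly misspecified `r*`,
`∫ (A(X) − μ[A(X)|σ(Z)])(Y − h(X) − r*(Z)) dμ
  = ∫ (A(X) − μ[A(X)|σ(Z)])(r(Z) − r*(Z)) dμ`. -/
theorem stmt_2
    {Ω : Type*} [m0 : MeasurableSpace Ω] {μ : Measure Ω} [IsProbabilityMeasure μ]
    {p d : ℕ}
    (X : Ω → (Fin p → ℝ)) (Z : Ω → (Fin d → ℝ)) (Y : Ω → ℝ)
    (hX : Measurable X) (hZ : Measurable Z)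
    (hZX : MeasurableSpace.comap Z inferInstance ≤ MeasurableSpace.comap X inferInstance)
    (hXm : MeasurableSpace.comap X inferInstance ≤ m0)
    (hYint : Integrable Y μ)
    (h : (Fin p → ℝ) → ℝ) (r : (Fin d → ℝ) → ℝ)
    (hh : Measurable h) (hr : Measurable r)
    (hhint : Integrable (fun ω => h (X ω)) μ)
    (hrint : Integrable (fun ω => r (Z ω)) μ)
    (hmodel : μ[Y | MeasurableSpace.comap X inferInstance]
      =ᵐ[μ] fun ω => h (X ω) + r (Z ω)) :
    ∀ A : (Fin p → ℝ) → ℝ, Measurable A → (∃ C, ∀ x, |A x| ≤ C) →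
    ∀ rstar : (Fin d → ℝ) → ℝ, Measurable rstar →
      Integrable (fun ω => rstar (Z ω)) μ →
    ∫ ω, (A (X ω) - (μ[fun ω' => A (X ω') | MeasurableSpace.comap Z inferInstance]) ω)
        * (Y ω - h (X ω) - rstar (Z ω)) ∂μ
      = ∫ ω, (A (X ω) - (μ[fun ω' => A (X ω') | MeasurableSpace.comap Z inferInstance]) ω)
        * (r (Z ω) - rstar (Z ω)) ∂μ := by
  intro A hA hC rstar hrs hrsint
  obtain ⟨C, hC⟩ := hC
  have hAX : @StronglyMeasurable _ _ _ (MeasurableSpace.comap X inferInstance)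
      (fun ω => A (X ω)) :=
    (hA.comp (comap_measurable X)).stronglyMeasurable
  have hbd : ∀ᵐ ω ∂μ,
      |(μ[fun ω' => A (X ω') | MeasurableSpace.comap Z inferInstance]) ω| ≤ C :=
    ae_bdd_abs_condExp_of_ae_bdd_abs (Filter.Eventually.of_forall fun ω => hC (X ω))
  have hE : @StronglyMeasurable _ _ _ (MeasurableSpace.comap X inferInstance)
      (μ[fun ω' => A (X ω') | MeasurableSpace.comap Z inferInstance]) :=
    stronglyMeasurable_condExp.mono hZX
  generalize μ[fun ω' => A (X ω') | MeasurableSpace.comap Z inferInstance] = E at hbd hE ⊢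
  obtain ⟨W, hW⟩ : ∃ W : Ω → ℝ, W = fun ω => A (X ω) - E ω := ⟨_, rfl⟩
  have hWm : @StronglyMeasurable _ _ _ (MeasurableSpace.comap X inferInstance) W := by
    rw [hW]; exact hAX.sub hE
  have hWb : ∀ᵐ ω ∂μ, ‖W ω‖ ≤ C + C := by
    filter_upwards [hbd] with ω hω
    rw [hW]
    exact (norm_sub_le _ _).trans (add_le_add (hC _) hω)
  have hWi : ∀ g : Ω → ℝ, Integrable g μ → Integrable (fun ω => W ω * g ω) μ := fun g hg =>
    hg.bdd_mul (hWm.mono hXm).aestronglyMeasurable hWb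
  have key : ∫ ω, W ω * Y ω ∂μ = ∫ ω, W ω * (h (X ω) + r (Z ω)) ∂μ := by
    have h1 := condExp_stronglyMeasurable_mul_of_bound hXm hWm hYint _ hWb
    have h2 := integral_condExp (μ := μ) (f := W * Y) hXm
    refine h2.symm.trans (integral_congr_ae ?_)
    filter_upwards [h1, hmodel] with ω a b
    rw [a, Pi.mul_apply, b]
  have hWω : ∀ ω, A (X ω) - E ω = W ω := fun ω => by rw [hW]
  simp only [hWω]
  have e1 : ∀ ω, W ω * (Y ω - h (X ω) - rstar (Z ω))
      = W ω * Y ω - W ω * (h (X ω) + rstar (Z ω)) := fun ω => by ring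
  have e2 : ∀ ω, W ω * (r (Z ω) - rstar (Z ω))
      = W ω * (h (X ω) + r (Z ω)) - W ω * (h (X ω) + rstar (Z ω)) := fun ω => by ring
  simp only [e1, e2]
  have i1 : Integrable (fun ω => W ω * (h (X ω) + rstar (Z ω))) μ := hWi _ (hhint.add hrsint)
  have i2 : Integrable (fun ω => W ω * (h (X ω) + r (Z ω))) μ := hWi _ (hhint.add hrint)
  rw [integral_sub (hWi _ hYint) i1, integral_sub i2 i1, key]
end

section
/- Suppose μ[Y | σ(X)] = h(X) + r(Z) μ-almost everywhere, with Y, h(X) and r(Z) integrable. Then for every bounded measurable function A : ℝ^p → ℝ and every measurable function r* : ℝ^d → ℝ with r*(Z) integrable (a possibly misspecified model for r), the estimating function remains mean zero provided the conditional expectation of A is correctly specified: ∫ (A(X) − μ[A(X) | σ(Z)]) · (Y − h(X) − r*(Z)) dμ = 0. -/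
open MeasureTheory

/-- Double robustness, second half (Lemma 1): under the interpretable model
`μ[Y | σ(X)] = h(X) + r(Z)` a.e., the estimating function remains mean zero
for a possibly misspecified `r*` provided `E[A(X) | Z]` is correctly
specified. -/
theorem stmt_3
    {Ω : Type*} [m0 : MeasurableSpace Ω] {μ : Measure Ω} [IsProbabilityMeasure μ]
    {p d : ℕ}
    (X : Ω → (Fin p → ℝ)) (Z : Ω → (Fin d → ℝ)) (Y : Ω → ℝ)
    (hX : Measurable X) (hZ : Measurable Z)
    (hZX : MeasurableSpace.comap Z inferInstance ≤ MeasurableSpace.comap X inferInstance)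
    (hXm : MeasurableSpace.comap X inferInstance ≤ m0)
    (hYint : Integrable Y μ)
    (h : (Fin p → ℝ) → ℝ) (r : (Fin d → ℝ) → ℝ)
    (hh : Measurable h) (hr : Measurable r)
    (hhint : Integrable (fun ω => h (X ω)) μ)
    (hrint : Integrable (fun ω => r (Z ω)) μ)
    (hmodel : μ[Y | MeasurableSpace.comap X inferInstance]
      =ᵐ[μ] fun ω => h (X ω) + r (Z ω)) :
    ∀ A : (Fin p → ℝ) → ℝ, Measurable A → (∃ C, ∀ x, |A x| ≤ C) →
    ∀ rstar : (Fin d → ℝ) → ℝ, Measurable rstar →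
      Integrable (fun ω => rstar (Z ω)) μ →
    ∫ ω, (A (X ω) - (μ[fun ω' => A (X ω') | MeasurableSpace.comap Z inferInstance]) ω)
      * (Y ω - h (X ω) - rstar (Z ω)) ∂μ = 0 := by
  intro A hA ⟨C, hC⟩ rs hrs hrsint
  have hZm : MeasurableSpace.comap Z inferInstance ≤ m0 := hZX.trans hXm
  have hAint : Integrable (fun ω => A (X ω)) μ :=
    Integrable.of_bound (hA.comp hX).aestronglyMeasurable C
      (Filter.Eventually.of_forall fun ω => hC (X ω))
  have hXmeas : Measurable[MeasurableSpace.comap X inferInstance] X :=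
    comap_measurable X
  have hZmeas : Measurable[MeasurableSpace.comap Z inferInstance] Z :=
    comap_measurable Z
  have hb := ae_bdd_norm_condExp_of_ae_bdd_norm
    (m := MeasurableSpace.comap Z inferInstance) (μ := μ) (f := fun ω => A (X ω)) (R := C)
    (Filter.Eventually.of_forall fun ω => hC (X ω))
  set E : Ω → ℝ := μ[fun ω' => A (X ω') | MeasurableSpace.comap Z inferInstance] with hE
  have hEsm : StronglyMeasurable[MeasurableSpace.comap Z inferInstance] E :=
    stronglyMeasurable_condExp
  have hEint : Integrable E μ := integrable_condExp
  have hDsm : StronglyMeasurable[MeasurableSpace.comap X inferInstance]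
      ((fun ω => A (X ω)) - E) :=
    (hA.comp hXmeas).stronglyMeasurable.sub (hEsm.mono hZX)
  have hDint : Integrable ((fun ω => A (X ω)) - E) μ := hAint.sub hEint
  have hDb : ∀ᵐ ω ∂μ, ‖((fun ω => A (X ω)) - E) ω‖ ≤ C + C := by
    filter_upwards [hb] with ω hω
    exact (norm_sub_le _ _).trans (add_le_add (hC (X ω)) hω)
  set D : Ω → ℝ := (fun ω => A (X ω)) - E with hD
  set W : Ω → ℝ := Y - (fun ω => h (X ω) + rs (Z ω)) with hW
  set V : Ω → ℝ := fun ω => h (X ω) + rs (Z ω) with hV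
  have hVint : Integrable V μ := hhint.add hrsint
  have hWint : Integrable W μ := hYint.sub hVint
  have hVsm : StronglyMeasurable[MeasurableSpace.comap X inferInstance] V :=
    (hh.comp hXmeas).stronglyMeasurable.add ((hrs.comp hZmeas).stronglyMeasurable.mono hZX)
  set g : Ω → ℝ := fun ω => r (Z ω) - rs (Z ω) with hg
  have hgint : Integrable g μ := hrint.sub hrsint
  have hgsm : StronglyMeasurable[MeasurableSpace.comap Z inferInstance] g :=
    (hr.comp hZmeas).stronglyMeasurable.sub (hrs.comp hZmeas).stronglyMeasurable
  have hWc : μ[W | MeasurableSpace.comap X inferInstance] =ᵐ[μ] g := by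
    have h1 := condExp_sub hYint hVint (MeasurableSpace.comap X inferInstance)
    rw [condExp_of_stronglyMeasurable hXm hVsm hVint] at h1
    filter_upwards [h1, hmodel] with ω a b
    rw [hW, a, Pi.sub_apply, b, hV, hg]
    ring
  have hDW : Integrable (D * W) μ :=
    hWint.bdd_mul hDint.aestronglyMeasurable hDb
  have hDg : Integrable (D * g) μ :=
    hgint.bdd_mul hDint.aestronglyMeasurable hDb
  have e1 := condExp_mul_of_stronglyMeasurable_left hDsm hDW hWint
  have e2 := condExp_mul_of_stronglyMeasurable_right hgsm hDg hDint
  have hDc : μ[D | MeasurableSpace.comap Z inferInstance] =ᵐ[μ] 0 := by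
    have h1 := condExp_sub hAint hEint (MeasurableSpace.comap Z inferInstance)
    rw [condExp_of_stronglyMeasurable hZm hEsm hEint] at h1
    filter_upwards [h1] with ω a
    rw [hD, a, Pi.sub_apply, hE]
    simp
  calc ∫ ω, (A (X ω) - E ω) * (Y ω - h (X ω) - rs (Z ω)) ∂μ
      = ∫ ω, (D * W) ω ∂μ := by
        congr 1
        ext ω
        simp only [hD, hW, Pi.mul_apply, Pi.sub_apply, hV]
        ring
    _ = ∫ ω, (μ[D * W | MeasurableSpace.comap X inferInstance]) ω ∂μ :=
        (integral_condExp hXm).symm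
    _ = ∫ ω, (D * g) ω ∂μ := by
        apply integral_congr_ae
        filter_upwards [e1, hWc] with ω a b
        rw [a, Pi.mul_apply, b, Pi.mul_apply]
    _ = ∫ ω, (μ[D * g | MeasurableSpace.comap Z inferInstance]) ω ∂μ :=
        (integral_condExp hZm).symm
    _ = ∫ ω, (0 : ℝ) ∂μ := by
        apply integral_congr_ae
        filter_upwards [e2, hDc] with ω a b
        rw [a, Pi.mul_apply, b]
        simp
    _ = 0 := by simp
end

section
/- Let g : ℝ → ℝ be differentiable with derivative g′ satisfying |g′(t)| ≥ c > 0 for all t. Suppose μ[Y | σ(X)] = g(h(X) + r(Z)) μ-almost everywhere, with Y and g(h(X) + r(Z)) integrable. Then for every bounded measurable A : ℝ^p → ℝ and every bounded measurable w : ℝ^d → ℝ, ∫ (A(X) − w(Z)) · (g′(h(X) + r(Z)))⁻¹ · (Y − g(h(X) + r(Z))) dμ = 0. -/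
open MeasureTheory

/-- Unbiasedness of the elements of Λ⊥ for the model with a known
differentiable link function `g` (Theorem 2): if `μ[Y | σ(X)] = g(h(X)+r(Z))`
a.e. and `|g′| ≥ c > 0`, then for bounded measurable `A` and `w`,
`∫ (A(X) − w(Z)) · (g′(h(X)+r(Z)))⁻¹ · (Y − g(h(X)+r(Z))) dμ = 0`. -/
theorem stmt_6
    {Ω : Type*} [m0 : MeasurableSpace Ω] {μ : Measure Ω} [IsProbabilityMeasure μ]
    {p d : ℕ}
    (X : Ω → (Fin p → ℝ)) (Z : Ω → (Fin d → ℝ)) (Y : Ω → ℝ)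
    (hX : Measurable X) (hZ : Measurable Z)
    (hZX : MeasurableSpace.comap Z inferInstance ≤ MeasurableSpace.comap X inferInstance)
    (hXm : MeasurableSpace.comap X inferInstance ≤ m0)
    (hYint : Integrable Y μ)
    (g : ℝ → ℝ) (hg : Differentiable ℝ g)
    (c : ℝ) (hc : 0 < c) (hg' : ∀ t, c ≤ |deriv g t|)
    (h : (Fin p → ℝ) → ℝ) (r : (Fin d → ℝ) → ℝ)
    (hh : Measurable h) (hr : Measurable r)
    (hgint : Integrable (fun ω => g (h (X ω) + r (Z ω))) μ)
    (hmodel : μ[Y | MeasurableSpace.comap X inferInstance]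
      =ᵐ[μ] fun ω => g (h (X ω) + r (Z ω))) :
    ∀ A : (Fin p → ℝ) → ℝ, Measurable A → (∃ C, ∀ x, |A x| ≤ C) →
    ∀ w : (Fin d → ℝ) → ℝ, Measurable w → (∃ C, ∀ z, |w z| ≤ C) →
    ∫ ω, (A (X ω) - w (Z ω)) * (deriv g (h (X ω) + r (Z ω)))⁻¹
      * (Y ω - g (h (X ω) + r (Z ω))) ∂μ = 0 := by
  intro A hA ⟨CA, hCA⟩ w hw ⟨Cw, hCw⟩
  let m : MeasurableSpace Ω := MeasurableSpace.comap X inferInstance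
  have hXc : Measurable[m] X := comap_measurable X
  have hZc : Measurable[m] Z := fun s hs => hZX _ ⟨s, hs, rfl⟩
  let f : Ω → ℝ := fun ω => (A (X ω) - w (Z ω)) * (deriv g (h (X ω) + r (Z ω)))⁻¹
  have hf1 : Measurable[m] fun ω => A (X ω) - w (Z ω) :=
    Measurable.sub (hA.comp hXc) (hw.comp hZc)
  have hf2 : Measurable[m] fun ω => h (X ω) + r (Z ω) :=
    Measurable.add (hh.comp hXc) (hr.comp hZc)
  have hf3 : Measurable[m] fun ω => (deriv g (h (X ω) + r (Z ω)))⁻¹ :=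
    Measurable.inv ((measurable_deriv g).comp hf2)
  have hfm : Measurable[m] f := Measurable.mul hf1 hf3
  have hfs : StronglyMeasurable[m] f := Measurable.stronglyMeasurable hfm
  have hbd : ∀ ω, ‖f ω‖ ≤ (CA + Cw) * c⁻¹ := by
    intro ω
    have h1 : |A (X ω) - w (Z ω)| ≤ CA + Cw :=
      (abs_sub _ _).trans (add_le_add (hCA _) (hCw _))
    have h2 : |deriv g (h (X ω) + r (Z ω))|⁻¹ ≤ c⁻¹ := inv_anti₀ hc (hg' _)
    simp only [f, norm_mul, norm_inv, Real.norm_eq_abs]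
    exact mul_le_mul h1 h2 (by positivity) ((abs_nonneg _).trans h1)
  have hfa : AEStronglyMeasurable[m0] f μ := (hfs.mono hXm).aestronglyMeasurable
  have hiY : Integrable (fun ω => f ω * Y ω) μ :=
    hYint.bdd_mul hfa (Filter.Eventually.of_forall hbd)
  have hiG : Integrable (fun ω => f ω * g (h (X ω) + r (Z ω))) μ :=
    hgint.bdd_mul hfa (Filter.Eventually.of_forall hbd)
  have hpull : μ[f * Y | m] =ᵐ[μ] f * μ[Y | m] :=
    condExp_mul_of_stronglyMeasurable_left hfs hiY hYint
  have key : ∫ ω, f ω * Y ω ∂μ = ∫ ω, f ω * g (h (X ω) + r (Z ω)) ∂μ := by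
    have e1 : ∫ ω, (μ[f * Y | m]) ω ∂μ = ∫ ω, (f * Y) ω ∂μ := integral_condExp hXm
    refine e1.symm.trans (integral_congr_ae ?_)
    filter_upwards [hpull, hmodel] with ω h1 h2
    rw [h1, Pi.mul_apply, h2]
  change ∫ ω, f ω * (Y ω - g (h (X ω) + r (Z ω))) ∂μ = 0
  simp only [mul_sub]
  rw [integral_sub hiY hiG, key, sub_self]
end

section
/- Suppose the sufficient dimension reduction assumption holds: μ[Y | σ(X)] = μ[Y | σ(Z)] μ-almost everywhere, with Y integrable. Then for every bounded measurable function α : ℝ^p → ℝ, the semiparametric SDR estimating function has mean zero: ∫ (Y − μ[Y | σ(Z)]) · (α(X) − μ[α(X) | σ(Z)]) dμ = 0. -/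
open MeasureTheory

theorem stmt_8_aux {Ω : Type*} {m1 m2 m0 : MeasurableSpace Ω} {μ : Measure Ω}
    [IsProbabilityMeasure μ] (h12 : m1 ≤ m2) (h2 : m2 ≤ m0) (Y A : Ω → ℝ)
    (hY : Integrable Y μ) (hA : StronglyMeasurable[m2] A) (C : ℝ) (hC : ∀ ω, |A ω| ≤ C)
    (h : μ[Y | m2] =ᵐ[μ] μ[Y | m1]) :
    ∫ ω, (Y ω - (μ[Y | m1]) ω) * (A ω - (μ[A | m1]) ω) ∂μ = 0 := by
  have hC0 : ∀ᵐ ω ∂μ, |A ω| ≤ (C.toNNReal : ℝ) :=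
    Filter.Eventually.of_forall fun ω => (hC ω).trans (Real.le_coe_toNNReal C)
  have hb : ∀ᵐ ω ∂μ, |(μ[A | m1]) ω| ≤ (C.toNNReal : ℝ) := ae_bdd_condExp_of_ae_bdd hC0
  have hW : StronglyMeasurable[m2] (A - μ[A | m1]) :=
    hA.sub (stronglyMeasurable_condExp.mono h12)
  have hU : Integrable (Y - μ[Y | m1]) μ := hY.sub integrable_condExp
  have hUW : Integrable ((Y - μ[Y | m1]) * (A - μ[A | m1])) μ := by
    refine hU.mul_bdd (c := C.toNNReal + C.toNNReal) (hW.mono h2).aestronglyMeasurable ?_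
    filter_upwards [hC0, hb] with ω h1 h2
    exact (abs_sub _ _).trans (add_le_add h1 h2)
  have hz : μ[Y - μ[Y | m1] | m2] =ᵐ[μ] 0 := by
    have h3 := condExp_sub hY (integrable_condExp (m := m1) (f := Y) (μ := μ)) m2
    rw [condExp_of_stronglyMeasurable h2 (stronglyMeasurable_condExp.mono h12)
      integrable_condExp] at h3
    filter_upwards [h3, h] with ω h4 h5
    rw [h4, Pi.sub_apply, h5, sub_self, Pi.zero_apply]
  have hp := condExp_mul_of_stronglyMeasurable_right hW hUW hU
  change ∫ ω, ((Y - μ[Y | m1]) * (A - μ[A | m1])) ω ∂μ = 0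
  rw [← integral_condExp h2]
  apply integral_eq_zero_of_ae
  filter_upwards [hp, hz] with ω h4 h5
  rw [h4, Pi.mul_apply, h5, Pi.zero_apply, zero_mul]

/-- Unbiasedness of the Ma–Zhu semiparametric SDR estimating equation: under
the SDR assumption `μ[Y | σ(X)] = μ[Y | σ(Z)]` a.e., for every bounded
measurable `α`, `∫ (Y − μ[Y|σ(Z)]) · (α(X) − μ[α(X)|σ(Z)]) dμ = 0`. -/
theorem stmt_8
    {Ω : Type*} [m0 : MeasurableSpace Ω] {μ : Measure Ω} [IsProbabilityMeasure μ]
    {p d : ℕ}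
    (X : Ω → (Fin p → ℝ)) (Z : Ω → (Fin d → ℝ)) (Y : Ω → ℝ)
    (hX : Measurable X) (hZ : Measurable Z)
    (hZX : MeasurableSpace.comap Z inferInstance ≤ MeasurableSpace.comap X inferInstance)
    (hXm : MeasurableSpace.comap X inferInstance ≤ m0)
    (hYint : Integrable Y μ)
    (hSDR : μ[Y | MeasurableSpace.comap X inferInstance]
      =ᵐ[μ] μ[Y | MeasurableSpace.comap Z inferInstance]) :
    ∀ α : (Fin p → ℝ) → ℝ, Measurable α → (∃ C, ∀ x, |α x| ≤ C) →
    ∫ ω, (Y ω - (μ[Y | MeasurableSpace.comap Z inferInstance]) ω)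
      * (α (X ω) - (μ[fun ω' => α (X ω') | MeasurableSpace.comap Z inferInstance]) ω) ∂μ
      = 0 := by
  rintro α hα ⟨C, hC⟩
  exact stmt_8_aux hZX hXm Y (fun ω => α (X ω)) hYint
    (hα.comp (comap_measurable X)).stronglyMeasurable C (fun ω => hC _) hSDR
end

section
/- Suppose the sufficient dimension reduction assumption holds: μ[Y | σ(X)] = μ[Y | σ(Z)] μ-almost everywhere, with Y integrable. Then for every bounded measurable α : ℝ^p → ℝ and every measurable b : ℝ^d → ℝ with b(Z) integrable (a possibly misspecified model for E[Y | Z]), ∫ (Y − b(Z)) · (α(X) − μ[α(X) | σ(Z)]) dμ = 0. -/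
open MeasureTheory

theorem aux_dr {Ω : Type*} {m0 : MeasurableSpace Ω} {μ : Measure Ω} [IsProbabilityMeasure μ]
    (mX mZ : MeasurableSpace Ω) (hZX : mZ ≤ mX) (hXm : mX ≤ m0)
    (Y A B : Ω → ℝ) (hY : Integrable Y μ) (hSDR : μ[Y | mX] =ᵐ[μ] μ[Y | mZ])
    (hA : StronglyMeasurable[mX] A) (C : ℝ) (hC : ∀ ω, |A ω| ≤ C)
    (hB : StronglyMeasurable[mZ] B) (hBi : Integrable B μ) :
    ∫ ω, (Y ω - B ω) * (A ω - (μ[A | mZ]) ω) ∂μ = 0 := by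
  have hZm : mZ ≤ m0 := hZX.trans hXm
  have hAi : Integrable A μ :=
    Integrable.of_bound (hA.mono hXm).aestronglyMeasurable C (ae_of_all _ hC)
  have hEb : ∀ᵐ ω ∂μ, |(μ[A | mZ]) ω| ≤ C.toNNReal :=
    ae_bdd_condExp_of_ae_bdd (ae_of_all _ fun ω => (hC ω).trans (Real.le_coe_toNNReal C))
  set W : Ω → ℝ := A - μ[A | mZ] with hW
  have hWm : StronglyMeasurable[mX] W := hA.sub (stronglyMeasurable_condExp.mono hZX)
  have hWb : ∀ᵐ ω ∂μ, ‖W ω‖ ≤ C + C.toNNReal := by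
    filter_upwards [hEb] with ω h
    exact (norm_sub_le _ _).trans (add_le_add (hC ω) h)
  have hWi : Integrable W μ := hAi.sub integrable_condExp
  have hWas := (hWm.mono hXm).aestronglyMeasurable (μ := μ)
  have hW0 : μ[W | mZ] =ᵐ[μ] 0 := by
    have h1 := condExp_sub hAi (integrable_condExp (μ := μ) (m := mZ) (f := A)) mZ
    have h2 := condExp_of_stronglyMeasurable hZm
      (stronglyMeasurable_condExp (μ := μ) (m := mZ) (f := A)) integrable_condExp
    filter_upwards [h1] with ω h
    rw [hW, h, Pi.sub_apply, h2]; simp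
  set U : Ω → ℝ := Y - B with hU
  have hUi : Integrable U μ := hY.sub hBi
  set g : Ω → ℝ := μ[Y | mZ] - B with hg
  have hgm : StronglyMeasurable[mZ] g := stronglyMeasurable_condExp.sub hB
  have hgi : Integrable g μ := integrable_condExp.sub hBi
  have hUg : μ[U | mX] =ᵐ[μ] g := by
    have h1 := condExp_sub hY hBi mX
    have h2 := condExp_of_stronglyMeasurable hXm (hB.mono hZX) hBi
    filter_upwards [h1, hSDR] with ω h h'
    rw [hU, h, Pi.sub_apply, h2, h', hg, Pi.sub_apply]
  have e1 : μ[U * W | mX] =ᵐ[μ] μ[U | mX] * W :=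
    condExp_mul_of_stronglyMeasurable_right hWm (hUi.mul_bdd hWas hWb) hUi
  have e2 : μ[g * W | mZ] =ᵐ[μ] g * μ[W | mZ] :=
    condExp_mul_of_stronglyMeasurable_left hgm (hgi.mul_bdd hWas hWb) hWi
  calc ∫ ω, (U * W) ω ∂μ = ∫ ω, (μ[U * W | mX]) ω ∂μ := (integral_condExp hXm).symm
    _ = ∫ ω, (g * W) ω ∂μ := by
      apply integral_congr_ae
      filter_upwards [e1, hUg] with ω h h'
      rw [h, Pi.mul_apply, h', Pi.mul_apply]
    _ = ∫ ω, (μ[g * W | mZ]) ω ∂μ := (integral_condExp hZm).symm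
    _ = ∫ ω, (0 : ℝ) ∂μ := by
      apply integral_congr_ae
      filter_upwards [e2, hW0] with ω h h'
      rw [h, Pi.mul_apply, h']; simp
    _ = 0 := by simp

/-- Double robustness of the Ma–Zhu SDR estimating equation, first direction:
under the SDR assumption, the estimating function is mean zero for any
possibly misspecified model `b` for `E[Y | Z]`, provided `E[α(X) | Z]` is
correctly specified. -/
theorem stmt_9
    {Ω : Type*} [m0 : MeasurableSpace Ω] {μ : Measure Ω} [IsProbabilityMeasure μ]
    {p d : ℕ}
    (X : Ω → (Fin p → ℝ)) (Z : Ω → (Fin d → ℝ)) (Y : Ω → ℝ)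
    (hX : Measurable X) (hZ : Measurable Z)
    (hZX : MeasurableSpace.comap Z inferInstance ≤ MeasurableSpace.comap X inferInstance)
    (hXm : MeasurableSpace.comap X inferInstance ≤ m0)
    (hYint : Integrable Y μ)
    (hSDR : μ[Y | MeasurableSpace.comap X inferInstance]
      =ᵐ[μ] μ[Y | MeasurableSpace.comap Z inferInstance]) :
    ∀ α : (Fin p → ℝ) → ℝ, Measurable α → (∃ C, ∀ x, |α x| ≤ C) →
    ∀ b : (Fin d → ℝ) → ℝ, Measurable b → Integrable (fun ω => b (Z ω)) μ →
    ∫ ω, (Y ω - b (Z ω))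
      * (α (X ω) - (μ[fun ω' => α (X ω') | MeasurableSpace.comap Z inferInstance]) ω) ∂μ
      = 0 := by
  intro α hα ⟨C, hC⟩ b hb hbi
  exact aux_dr _ _ hZX hXm Y (fun ω => α (X ω)) (fun ω => b (Z ω)) hYint hSDR
    (hα.comp (comap_measurable X)).stronglyMeasurable C (fun ω => hC _)
    (hb.comp (comap_measurable Z)).stronglyMeasurable hbi
end

section
/- Suppose the sufficient dimension reduction assumption holds: μ[Y | σ(X)] = μ[Y | σ(Z)] μ-almost everywhere, with Y integrable. Then for every bounded measurable α : ℝ^p → ℝ and every bounded measurable a : ℝ^d → ℝ (a possibly misspecified model for E[α(X) | Z]), ∫ (Y − μ[Y | σ(Z)]) · (α(X) − a(Z)) dμ = 0. -/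
open MeasureTheory

/-- Double robustness of the Ma–Zhu SDR estimating equation, second direction:
under the SDR assumption, the estimating function is mean zero for any
possibly misspecified bounded measurable model `a` for `E[α(X) | Z]`,
provided `E[Y | Z]` is correctly specified. -/
theorem stmt_10
    {Ω : Type*} [m0 : MeasurableSpace Ω] {μ : Measure Ω} [IsProbabilityMeasure μ]
    {p d : ℕ}
    (X : Ω → (Fin p → ℝ)) (Z : Ω → (Fin d → ℝ)) (Y : Ω → ℝ)
    (hX : Measurable X) (hZ : Measurable Z)
    (hZX : MeasurableSpace.comap Z inferInstance ≤ MeasurableSpace.comap X inferInstance)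
    (hXm : MeasurableSpace.comap X inferInstance ≤ m0)
    (hYint : Integrable Y μ)
    (hSDR : μ[Y | MeasurableSpace.comap X inferInstance]
      =ᵐ[μ] μ[Y | MeasurableSpace.comap Z inferInstance]) :
    ∀ α : (Fin p → ℝ) → ℝ, Measurable α → (∃ C, ∀ x, |α x| ≤ C) →
    ∀ a : (Fin d → ℝ) → ℝ, Measurable a → (∃ C, ∀ z, |a z| ≤ C) →
    ∫ ω, (Y ω - (μ[Y | MeasurableSpace.comap Z inferInstance]) ω)
      * (α (X ω) - a (Z ω)) ∂μ = 0 := by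
  rintro α hα ⟨C, hC⟩ a ha ⟨D, hD⟩
  set mX : MeasurableSpace Ω := MeasurableSpace.comap X inferInstance with hmX
  set mZ : MeasurableSpace Ω := MeasurableSpace.comap Z inferInstance with hmZ
  set g : Ω → ℝ := fun ω => α (X ω) - a (Z ω) with hg
  have hXX : Measurable[mX] X := comap_measurable X
  have hZZ : Measurable[mX] Z := (comap_measurable Z).mono hZX le_rfl
  have hgm : StronglyMeasurable[mX] g :=
    ((hα.comp hXX).sub (ha.comp hZZ)).stronglyMeasurable
  have hgb : ∀ᵐ ω ∂μ, ‖g ω‖ ≤ C + D := Filter.Eventually.of_forall fun ω => by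
    have h1 := abs_sub (α (X ω)) (a (Z ω))
    have h2 := hC (X ω)
    have h3 := hD (Z ω)
    rw [Real.norm_eq_abs]
    exact h1.trans (add_le_add h2 h3)
  have hint : Integrable (Y - μ[Y | mX]) μ := hYint.sub integrable_condExp
  have hpull := condExp_stronglyMeasurable_mul_of_bound hXm hgm hint (C + D) hgb
  have hzero : μ[Y - μ[Y | mX] | mX] =ᵐ[μ] 0 := by
    have h1 := condExp_sub hYint (integrable_condExp (μ := μ) (m := mX) (f := Y)) mX
    rw [condExp_of_stronglyMeasurable hXm stronglyMeasurable_condExp integrable_condExp,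
      sub_self] at h1
    exact h1
  calc ∫ ω, (Y ω - (μ[Y | mZ]) ω) * (α (X ω) - a (Z ω)) ∂μ
      = ∫ ω, (g * (Y - μ[Y | mX])) ω ∂μ := by
        apply integral_congr_ae
        filter_upwards [hSDR] with ω h
        simp only [Pi.mul_apply, Pi.sub_apply, h, hg]
        ring
    _ = ∫ ω, (μ[g * (Y - μ[Y | mX]) | mX]) ω ∂μ := (integral_condExp hXm).symm
    _ = 0 := by
        apply integral_eq_zero_of_ae
        filter_upwards [hpull, hzero] with ω h1 h2
        rw [h1, Pi.mul_apply, h2]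
        simp
end
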